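/- Assume k > 2 and set x̄_c = Λ₀·(k−2)/(k·(1+η)). Then x̄_c ∈ (0, Λ₀/(1+η)), H''(x) > 0 for x ∈ (0, x̄_c), H''(x) < 0 for x ∈ (x̄_c, Λ₀/(1+η)), H'(x) → −(1+η)/Λ₀ < 0 as x → 0⁺, and H'(Λ₀/(1+η)) < 0. Consequently: (a) if H'(x̄_c) < 0 then H'(x) < 0 for all x ∈ (0, Λ₀/(1+η)]; (b) if H'(x̄_c) = 0 then x̄_c is the unique zero of H' and H'(x) < 0 for all x ≠ x̄_c; (c) if H'(x̄_c) > 0 then H' has exactly two zeros x₀₁ < x₀₂ in (0, Λ₀/(1+η)), with x₀₁ < x̄_c < x₀₂, H' < 0 on (0, x₀₁), H' > 0 on (x₀₁, x₀₂), and H' < 0 on (x₀₂, Λ₀/(1+η)]. -/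

import Mathlib

/-- The function `H(x) = (1+p·x^(k−1))·(1 − (1+η)x/Λ₀) − γ/Λ₀`. -/
noncomputable def Hfun (p Λ₀ γ η k : ℝ) (x : ℝ) : ℝ :=
  (1 + p * x ^ (k - 1)) * (1 - (1 + η) * x / Λ₀) - γ / Λ₀

lemma Hfun_hasDerivAt (p Λ₀ γ η k x : ℝ) (hk : 2 < k) :
    HasDerivAt (Hfun p Λ₀ γ η k)
      (p * ((k - 1) * x ^ (k - 2)) * (1 - (1 + η) * x / Λ₀)
        + (1 + p * x ^ (k - 1)) * (-((1 + η) / Λ₀))) x := by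
  have h1 : HasDerivAt (fun x : ℝ => x ^ (k - 1)) ((k - 1) * x ^ (k - 1 - 1)) x :=
    Real.hasDerivAt_rpow_const (Or.inr (by linarith))
  have e : k - 1 - 1 = k - 2 := by ring
  rw [e] at h1
  have h2 : HasDerivAt (fun x : ℝ => 1 - (1 + η) * x / Λ₀) (-((1 + η) / Λ₀)) x := by
    have := (((hasDerivAt_id x).const_mul (1 + η)).div_const Λ₀).const_sub 1
    simpa using this
  exact (((h1.const_mul p).const_add 1).mul h2).sub_const (γ / Λ₀)

lemma Hfun_deriv_eq (p Λ₀ γ η k : ℝ) (hk : 2 < k) :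
    deriv (Hfun p Λ₀ γ η k) = fun x => p * ((k - 1) * x ^ (k - 2)) * (1 - (1 + η) * x / Λ₀)
        + (1 + p * x ^ (k - 1)) * (-((1 + η) / Λ₀)) :=
  funext fun x => (Hfun_hasDerivAt p Λ₀ γ η k x hk).deriv

lemma Hfun_deriv_deriv (p Λ₀ γ η k x : ℝ) (hk : 2 < k) (hx : 0 < x) :
    deriv (deriv (Hfun p Λ₀ γ η k)) x
      = p * (k - 1) * x ^ (k - 3) * (k - 2 - k * ((1 + η) * x / Λ₀)) := by
  rw [Hfun_deriv_eq _ _ _ _ _ hk]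
  have h1 : HasDerivAt (fun x : ℝ => x ^ (k - 1)) ((k - 1) * x ^ (k - 1 - 1)) x :=
    Real.hasDerivAt_rpow_const (Or.inl hx.ne')
  have h3 : HasDerivAt (fun x : ℝ => x ^ (k - 2)) ((k - 2) * x ^ (k - 2 - 1)) x :=
    Real.hasDerivAt_rpow_const (Or.inl hx.ne')
  have e : k - 1 - 1 = (k - 3) + 1 := by ring
  have e2 : k - 2 - 1 = k - 3 := by ring
  have e3 : k - 2 = (k - 3) + 1 := by ring
  have e4 : x ^ (k - 2) = x ^ (k - 3) * x := by rw [e3, Real.rpow_add_one hx.ne']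
  rw [e, Real.rpow_add_one hx.ne'] at h1
  rw [e2] at h3
  have h2 : HasDerivAt (fun x : ℝ => 1 - (1 + η) * x / Λ₀) (-((1 + η) / Λ₀)) x := by
    have := (((hasDerivAt_id x).const_mul (1 + η)).div_const Λ₀).const_sub 1
    simpa using this
  have h := ((((h3.const_mul (k - 1)).const_mul p).mul h2).add
    (((h1.const_mul p).const_add 1).mul_const (-((1 + η) / Λ₀)))).deriv
  refine Eq.trans h ?_
  rw [e4]
  ring

/-- Shape of a continuous function that increases and then decreases. -/
lemma unimodal_shape (G : ℝ → ℝ) (c X : ℝ) (hc : 0 < c) (hcX : c < X) (hG : Continuous G)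
    (hm : StrictMonoOn G (Set.Icc 0 c)) (ha : StrictAntiOn G (Set.Icc c X))
    (h0 : G 0 < 0) (hX : G X < 0) :
    (G c < 0 → ∀ x ∈ Set.Ioc (0 : ℝ) X, G x < 0) ∧
    (G c = 0 → (∀ x ∈ Set.Ioc (0 : ℝ) X, G x = 0 → x = c) ∧
      (∀ x ∈ Set.Ioc (0 : ℝ) X, x ≠ c → G x < 0)) ∧
    (0 < G c → ∃ a b : ℝ, a ∈ Set.Ioo (0 : ℝ) X ∧ b ∈ Set.Ioo (0 : ℝ) X ∧
        a < c ∧ c < b ∧ G a = 0 ∧ G b = 0 ∧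
        (∀ x ∈ Set.Ioo (0 : ℝ) X, G x = 0 → x = a ∨ x = b) ∧
        (∀ x ∈ Set.Ioo (0 : ℝ) a, G x < 0) ∧
        (∀ x ∈ Set.Ioo a b, 0 < G x) ∧
        (∀ x ∈ Set.Ioc b X, G x < 0)) := by
  have key : ∀ x ∈ Set.Ioc (0 : ℝ) X, x ≠ c → G x < G c := by
    intro x hx hne
    rcases lt_or_gt_of_ne hne with h | h
    · exact hm ⟨hx.1.le, h.le⟩ ⟨hc.le, le_rfl⟩ h
    · exact ha ⟨le_rfl, hcX.le⟩ ⟨h.le, hx.2⟩ h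
  refine ⟨fun h x hx => ?_, fun h => ?_, fun h => ?_⟩
  · by_cases e : x = c
    · rwa [e]
    · exact (key x hx e).trans h
  · have k2 : ∀ x ∈ Set.Ioc (0 : ℝ) X, x ≠ c → G x < 0 := fun x hx e => h ▸ key x hx e
    refine ⟨fun x hx h0 => ?_, k2⟩
    by_contra e
    exact (k2 x hx e).ne h0
  · obtain ⟨a, ha', hGa⟩ := intermediate_value_Ioo hc.le hG.continuousOn
      (show (0 : ℝ) ∈ Set.Ioo (G 0) (G c) from ⟨h0, h⟩)
    obtain ⟨b, hb', hGb⟩ := intermediate_value_Ioo' hcX.le hG.continuousOn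
      (show (0 : ℝ) ∈ Set.Ioo (G X) (G c) from ⟨hX, h⟩)
    obtain ⟨ha0, hac⟩ := ha'
    obtain ⟨hcb, hbX⟩ := hb'
    have n1 : ∀ x ∈ Set.Ioo (0 : ℝ) a, G x < 0 := fun x hx =>
      hGa ▸ hm ⟨hx.1.le, (hx.2.trans hac).le⟩ ⟨ha0.le, hac.le⟩ hx.2
    have n2 : ∀ x ∈ Set.Ioo a b, 0 < G x := by
      intro x hx
      rcases le_total x c with e | e
      · exact hGa ▸ hm ⟨ha0.le, hac.le⟩ ⟨(ha0.trans hx.1).le, e⟩ hx.1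
      · exact hGb ▸ ha ⟨e, (hx.2.trans hbX).le⟩ ⟨hcb.le, hbX.le⟩ hx.2
    have n3 : ∀ x ∈ Set.Ioc b X, G x < 0 := fun x hx =>
      hGb ▸ ha ⟨hcb.le, hbX.le⟩ ⟨(hcb.trans hx.1).le, hx.2⟩ hx.1
    refine ⟨a, b, ⟨ha0, hac.trans hcX⟩, ⟨hc.trans hcb, hbX⟩, hac, hcb, hGa, hGb, ?_, n1, n2, n3⟩
    intro x hx hx0
    rcases lt_trichotomy x a with e | e | e
    · exact absurd hx0 (n1 x ⟨hx.1, e⟩).ne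
    · exact Or.inl e
    · rcases lt_trichotomy x b with f | f | f
      · exact absurd hx0 (n2 x ⟨e, f⟩).ne'
      · exact Or.inr f
      · exact absurd hx0 (n3 x ⟨f, hx.2.le⟩).ne

/-- For `k > 2`, with `x̄_c = Λ₀(k−2)/(k(1+η))`: `x̄_c ∈ (0, Λ₀/(1+η))`,
`H'' > 0` on `(0, x̄_c)`, `H'' < 0` on `(x̄_c, Λ₀/(1+η))`, `H'(x) → −(1+η)/Λ₀ < 0` as
`x → 0⁺`, and `H'(Λ₀/(1+η)) < 0`. Consequently:
(a) if `H'(x̄_c) < 0` then `H' < 0` on `(0, Λ₀/(1+η)]`;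
(b) if `H'(x̄_c) = 0` then `x̄_c` is the unique zero of `H'` and `H' < 0` elsewhere;
(c) if `H'(x̄_c) > 0` then `H'` has exactly two zeros `x₀₁ < x̄_c < x₀₂` in `(0, Λ₀/(1+η))`,
with `H' < 0` on `(0, x₀₁)`, `H' > 0` on `(x₀₁, x₀₂)` and `H' < 0` on `(x₀₂, Λ₀/(1+η)]`. -/
theorem H_deriv_shape_of_k_gt_two
    (p Λ₀ γ η k xc : ℝ)
    (hp : 0 < p) (hΛ : 0 < Λ₀) (hη : 0 < η) (hγη : η < γ) (hk : 2 < k)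
    (hxcdef : xc = Λ₀ * (k - 2) / (k * (1 + η))) :
    xc ∈ Set.Ioo (0 : ℝ) (Λ₀ / (1 + η)) ∧
    (∀ x ∈ Set.Ioo (0 : ℝ) xc, 0 < deriv (deriv (Hfun p Λ₀ γ η k)) x) ∧
    (∀ x ∈ Set.Ioo xc (Λ₀ / (1 + η)), deriv (deriv (Hfun p Λ₀ γ η k)) x < 0) ∧
    Filter.Tendsto (deriv (Hfun p Λ₀ γ η k)) (nhdsWithin 0 (Set.Ioi 0))
      (nhds (-(1 + η) / Λ₀)) ∧
    -(1 + η) / Λ₀ < 0 ∧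
    deriv (Hfun p Λ₀ γ η k) (Λ₀ / (1 + η)) < 0 ∧
    (deriv (Hfun p Λ₀ γ η k) xc < 0 →
      ∀ x ∈ Set.Ioc (0 : ℝ) (Λ₀ / (1 + η)), deriv (Hfun p Λ₀ γ η k) x < 0) ∧
    (deriv (Hfun p Λ₀ γ η k) xc = 0 →
      (∀ x ∈ Set.Ioc (0 : ℝ) (Λ₀ / (1 + η)), deriv (Hfun p Λ₀ γ η k) x = 0 → x = xc) ∧
      (∀ x ∈ Set.Ioc (0 : ℝ) (Λ₀ / (1 + η)), x ≠ xc → deriv (Hfun p Λ₀ γ η k) x < 0)) ∧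
    (0 < deriv (Hfun p Λ₀ γ η k) xc →
      ∃ x₀₁ x₀₂ : ℝ,
        x₀₁ ∈ Set.Ioo (0 : ℝ) (Λ₀ / (1 + η)) ∧ x₀₂ ∈ Set.Ioo (0 : ℝ) (Λ₀ / (1 + η)) ∧
        x₀₁ < xc ∧ xc < x₀₂ ∧
        deriv (Hfun p Λ₀ γ η k) x₀₁ = 0 ∧ deriv (Hfun p Λ₀ γ η k) x₀₂ = 0 ∧
        (∀ x ∈ Set.Ioo (0 : ℝ) (Λ₀ / (1 + η)),
          deriv (Hfun p Λ₀ γ η k) x = 0 → x = x₀₁ ∨ x = x₀₂) ∧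
        (∀ x ∈ Set.Ioo (0 : ℝ) x₀₁, deriv (Hfun p Λ₀ γ η k) x < 0) ∧
        (∀ x ∈ Set.Ioo x₀₁ x₀₂, 0 < deriv (Hfun p Λ₀ γ η k) x) ∧
        (∀ x ∈ Set.Ioc x₀₂ (Λ₀ / (1 + η)), deriv (Hfun p Λ₀ γ η k) x < 0)) := by
  have h1η : 0 < 1 + η := by linarith
  have hk0 : 0 < k := by linarith
  have hm : 0 < (1 + η) / Λ₀ := div_pos h1η hΛ
  have hc0 : 0 < xc := by
    rw [hxcdef]; exact div_pos (mul_pos hΛ (by linarith)) (mul_pos hk0 h1η)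
  have hcX : xc < Λ₀ / (1 + η) := by
    rw [hxcdef, div_lt_div_iff₀ (mul_pos hk0 h1η) h1η]
    nlinarith [mul_pos hΛ h1η]
  have hceq : k * ((1 + η) * xc / Λ₀) = k - 2 := by
    rw [hxcdef]; field_simp
  have hneg : -(1 + η) / Λ₀ < 0 := by rw [neg_div]; linarith
  have hcmp : ∀ x y : ℝ, x < y → k * ((1 + η) * x / Λ₀) < k * ((1 + η) * y / Λ₀) := by
    intro x y h
    gcongr
  have hpos : ∀ x ∈ Set.Ioo (0 : ℝ) xc, 0 < deriv (deriv (Hfun p Λ₀ γ η k)) x := by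
    intro x hx
    rw [Hfun_deriv_deriv _ _ _ _ _ _ hk hx.1]
    have := hcmp x xc hx.2
    exact mul_pos (mul_pos (mul_pos hp (by linarith)) (Real.rpow_pos_of_pos hx.1 _))
      (by linarith)
  have hng : ∀ x ∈ Set.Ioo xc (Λ₀ / (1 + η)), deriv (deriv (Hfun p Λ₀ γ η k)) x < 0 := by
    intro x hx
    have hx0 := hc0.trans hx.1
    rw [Hfun_deriv_deriv _ _ _ _ _ _ hk hx0]
    have := hcmp xc x hx.1
    exact mul_neg_of_pos_of_neg
      (mul_pos (mul_pos hp (by linarith)) (Real.rpow_pos_of_pos hx0 _)) (by linarith)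
  have hcont : Continuous (deriv (Hfun p Λ₀ γ η k)) := by
    rw [Hfun_deriv_eq _ _ _ _ _ hk]
    have c1 : Continuous fun x : ℝ => x ^ (k - 2) :=
      Real.continuous_rpow_const (by linarith)
    have c2 : Continuous fun x : ℝ => x ^ (k - 1) :=
      Real.continuous_rpow_const (by linarith)
    fun_prop
  have h0 : deriv (Hfun p Λ₀ γ η k) 0 = -(1 + η) / Λ₀ := by
    rw [Hfun_deriv_eq _ _ _ _ _ hk]
    simp only
    rw [Real.zero_rpow (by linarith), Real.zero_rpow (by linarith)]
    ring
  have hX : deriv (Hfun p Λ₀ γ η k) (Λ₀ / (1 + η)) < 0 := by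
    rw [Hfun_deriv_eq _ _ _ _ _ hk]
    have e : (1 + η) * (Λ₀ / (1 + η)) / Λ₀ = 1 := by field_simp
    simp only [e]
    have : 0 < p * (Λ₀ / (1 + η)) ^ (k - 1) :=
      mul_pos hp (Real.rpow_pos_of_pos (div_pos hΛ h1η) _)
    nlinarith
  have hmono : StrictMonoOn (deriv (Hfun p Λ₀ γ η k)) (Set.Icc 0 xc) :=
    strictMonoOn_of_deriv_pos (convex_Icc _ _) hcont.continuousOn
      (by rw [interior_Icc]; exact hpos)
  have hanti : StrictAntiOn (deriv (Hfun p Λ₀ γ η k)) (Set.Icc xc (Λ₀ / (1 + η))) :=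
    strictAntiOn_of_deriv_neg (convex_Icc _ _) hcont.continuousOn
      (by rw [interior_Icc]; exact hng)
  refine ⟨⟨hc0, hcX⟩, hpos, hng, ?_, hneg, hX,
    unimodal_shape _ _ _ hc0 hcX hcont hmono hanti (h0 ▸ hneg) hX⟩
  rw [← h0]
  exact hcont.continuousAt.tendsto.mono_left nhdsWithin_le_nhds
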